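/- arXiv:math/0510349 — 2 statements merged into one kernel-verified Lean document; each statement's English description precedes it below -/
import Mathlib

section
/- Let q be a power of a prime p, let n ≥ 1 and r ≥ 1 be integers, and let f_1, …, f_r be homogeneous polynomials in the variables x_0, …, x_n over the finite field 𝔽_q, of degrees d_1, …, d_r ≥ 1 with d_1 + ⋯ + d_r ≤ n. Let Z be the set of points x of the projective space ℙ^n(𝔽_q) (the projectivization of the vector space 𝔽_q^{n+1}) such that every nonzero vector v ∈ 𝔽_q^{n+1} representing x satisfies f_j(v) = 0 for all j = 1, …, r. Then the cardinality of Z is congruent to 1 modulo q. -/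
theorem Nat.exists_cyclic_digit_sums {p : ℕ} (hp : 1 < p) (a : ℕ) (m : ℕ) :
    ∃ g : ℕ → ℕ, (∀ l, g (l + a) = g l) ∧ (∀ l, g l ≡ p ^ l * m [MOD p ^ a - 1]) ∧
      (m ≠ 0 → ∀ l, g l ≠ 0) ∧
      (p - 1) * ∑ l ∈ Finset.range a, g l = (p ^ a - 1) * (p.digits m).sum := by
  induction m using Nat.strong_induction_on with
  | _ m ih =>
  rcases Nat.eq_zero_or_pos m with rfl | hm
  · exact ⟨fun _ => 0, by simp, by simp [Nat.ModEq.refl], by simp, by simp⟩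
  obtain ⟨g, hper, hmod, hpos, hsum⟩ := ih (m / p) (Nat.div_lt_self hm hp)
  have hcyc : ∀ l, p ^ (l % a) ≡ p ^ l [MOD p ^ a - 1] := fun l => by
    have h1 : p ^ a ≡ 1 [MOD p ^ a - 1] :=
      ((Nat.modEq_iff_dvd' (Nat.one_le_pow _ _ (by omega))).2 dvd_rfl).symm
    conv_rhs => rw [← Nat.mod_add_div l a, pow_add, pow_mul]
    simpa using ((h1.pow (l / a)).mul_left (p ^ (l % a))).symm
  refine ⟨fun l => (m % p) * p ^ (l % a) + g (l + 1), fun l => ?_, fun l => ?_, fun _ l => ?_, ?_⟩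
  · simp [← hper (l + 1), add_right_comm]
  · calc (m % p) * p ^ (l % a) + g (l + 1)
        ≡ (m % p) * p ^ l + p ^ (l + 1) * (m / p) [MOD p ^ a - 1] :=
          ((hcyc l).mul_left _).add (hmod _)
      _ = p ^ l * m := by
        conv_rhs => rw [← Nat.mod_add_div m p]
        ring
  · dsimp only
    rcases Nat.eq_zero_or_pos (m / p) with h | h
    · have hmp : m < p := (Nat.div_eq_zero_iff_lt (by omega)).1 h
      rw [Nat.mod_eq_of_lt hmp]
      have : 0 < m * p ^ (l % a) := by positivity
      omega
    · have := hpos h.ne' (l + 1)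
      omega
  · have hshift : ∑ l ∈ Finset.range a, g (l + 1) = ∑ l ∈ Finset.range a, g l := by
      have h := Finset.sum_range_succ' g a
      rw [Finset.sum_range_succ, ← zero_add a, hper, zero_add] at h
      omega
    have hgeom : (p - 1) * ∑ l ∈ Finset.range a, p ^ (l % a) = p ^ a - 1 := by
      rw [Finset.sum_congr rfl fun l hl => by rw [Nat.mod_eq_of_lt (Finset.mem_range.1 hl)],
        mul_comm, Nat.geomSum_eq hp, Nat.div_mul_cancel (Nat.sub_one_dvd_pow_sub_one p a)]
    rw [Finset.sum_add_distrib, ← Finset.mul_sum, mul_add, mul_left_comm, hgeom, hshift, hsum,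
      Nat.digits_of_two_le_of_pos hp hm, List.sum_cons]
    ring

theorem Nat.digits_sum_pow_mul_pow_sub_one {p : ℕ} (hp : 1 < p) {a : ℕ} (ha : a ≠ 0) (b : ℕ) :
    (p.digits (p ^ b * (p ^ a - 1))).sum = a * (p - 1) := by
  rw [Nat.digits_base_pow_mul hp (Nat.sub_pos_of_lt (Nat.one_lt_pow ha hp))]
  simp only [List.sum_append, List.sum_replicate, smul_zero, zero_add]
  clear ha
  induction a with
  | zero => simp
  | succ a ih =>
    have h1 : 1 ≤ p ^ a := Nat.one_le_pow _ _ (by omega)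
    have h : p ^ (a + 1) - 1 = (p - 1) + p * (p ^ a - 1) := by
      rw [Nat.mul_sub, pow_succ']
      have : p ≤ p * p ^ a := Nat.le_mul_of_pos_right _ h1
      omega
    rw [h, Nat.digits_add _ hp _ _ (by omega) (Or.inl (by omega)), List.sum_cons, ih]
    ring

theorem Nat.sub_one_mul_padicValNat_multinomial {p : ℕ} [hp : Fact p.Prime] {ι : Type*}
    (s : Finset ι) (k : ι → ℕ) :
    (p - 1) * padicValNat p (Nat.multinomial s k) + (p.digits (∑ i ∈ s, k i)).sum =
      ∑ i ∈ s, (p.digits (k i)).sum := by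
  have hval (m : ℕ) : (p - 1) * padicValNat p m.factorial + (p.digits m).sum = m := by
    rw [sub_one_mul_padicValNat_factorial, Nat.sub_add_cancel (Nat.digit_sum_le p m)]
  have hprod : padicValNat p (∏ i ∈ s, (k i).factorial) =
      ∑ i ∈ s, padicValNat p (k i).factorial := by
    classical
    induction s using Finset.induction_on with
    | empty => simp
    | insert i s hi ih =>
      rw [Finset.prod_insert hi, Finset.sum_insert hi, padicValNat.mul (Nat.factorial_ne_zero _)
        (Finset.prod_ne_zero_iff.2 fun _ _ => Nat.factorial_ne_zero _), ih]
  have hspec := congrArg (padicValNat p) (Nat.multinomial_spec s k)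
  rw [padicValNat.mul (Finset.prod_ne_zero_iff.2 fun _ _ => Nat.factorial_ne_zero _)
    (Nat.multinomial_pos s k).ne', hprod] at hspec
  have h1 := hval (∑ i ∈ s, k i)
  have h2 : ∑ i ∈ s, ((p - 1) * padicValNat p (k i).factorial + (p.digits (k i)).sum) =
    ∑ i ∈ s, k i := Finset.sum_congr rfl fun i _ => hval (k i)
  rw [Finset.sum_add_distrib, ← Finset.mul_sum] at h2
  rw [← hspec, mul_add] at h1
  omega

theorem Nat.pow_dvd_multinomial_of_weights {p : ℕ} [hp : Fact p.Prime] {a : ℕ} (ha : a ≠ 0) (b : ℕ)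
    {ι σ : Type*} [Fintype σ] (s : Finset ι) (k : ι → ℕ) (e : ι → σ → ℕ)
    (hk : ∑ i ∈ s, k i = p ^ b * (p ^ a - 1)) (he : ∀ i ∈ s, ∑ j, e i j < Fintype.card σ)
    (hdvd : ∀ j, p ^ a - 1 ∣ ∑ i ∈ s, k i * e i j) (hne : ∀ j, ∑ i ∈ s, k i * e i j ≠ 0) :
    p ^ a ∣ Nat.multinomial s k := by
  have hp1 := hp.out.one_lt
  have hQ : 0 < p ^ a - 1 := Nat.sub_pos_of_lt (Nat.one_lt_pow ha hp1)
  choose g _ hmod hpos hsum using Nat.exists_cyclic_digit_sums hp1 a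
  have hσ : 0 < Fintype.card σ := by
    have : ∑ i ∈ s, k i ≠ 0 := by rw [hk]; positivity
    obtain ⟨i, hi, -⟩ := Finset.exists_ne_zero_of_sum_ne_zero this
    exact (Nat.zero_le _).trans_lt (he i hi)
  have hmodsum (l : ℕ) (w : ι → ℕ) :
      ∑ i ∈ s, g (k i) l * w i ≡ p ^ l * ∑ i ∈ s, k i * w i [MOD p ^ a - 1] := by
    rw [Finset.mul_sum]
    refine Nat.ModEq.sum fun i _ => ?_
    rw [← mul_assoc]
    exact (hmod (k i) l).mul_right _
  have hcol (l : ℕ) (j : σ) : p ^ a - 1 ≤ ∑ i ∈ s, g (k i) l * e i j := by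
    refine Nat.le_of_dvd (Nat.pos_of_ne_zero fun h0 => ?_) ?_
    · obtain ⟨i, hi, hi0⟩ := Finset.exists_ne_zero_of_sum_ne_zero (hne j)
      rw [Finset.sum_eq_zero_iff] at h0
      exact mul_ne_zero (hpos _ (left_ne_zero_of_mul hi0) l) (right_ne_zero_of_mul hi0) (h0 i hi)
    · exact ((hmodsum l fun i => e i j).dvd_iff dvd_rfl).2 ((hdvd j).mul_left _)
  have hrow (l : ℕ) : 2 * (p ^ a - 1) ≤ ∑ i ∈ s, g (k i) l := by
    have hlt : p ^ a - 1 < ∑ i ∈ s, g (k i) l := by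
      by_contra! hle
      have h1 : Fintype.card σ * (p ^ a - 1) ≤ ∑ j, ∑ i ∈ s, g (k i) l * e i j := by
        simpa using Finset.card_nsmul_le_sum Finset.univ _ _ fun j _ => hcol l j
      rw [Finset.sum_comm] at h1
      have h2 : ∑ i ∈ s, ∑ j, g (k i) l * e i j ≤
          (∑ i ∈ s, g (k i) l) * (Fintype.card σ - 1) := by
        rw [Finset.sum_mul]
        refine Finset.sum_le_sum fun i hi => ?_
        rw [← Finset.mul_sum]
        exact Nat.mul_le_mul_left _ (Nat.le_sub_one_of_lt (he i hi))
      have h3 := h1.trans (h2.trans (Nat.mul_le_mul_right _ hle))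
      rw [mul_comm] at h3
      have := Nat.le_of_mul_le_mul_left h3 hQ
      omega
    have hd : p ^ a - 1 ∣ ∑ i ∈ s, g (k i) l := by
      have := hmodsum l 1
      simp only [Pi.one_apply, mul_one, hk] at this
      exact (this.dvd_iff dvd_rfl).2 ((dvd_mul_left _ _).mul_left _)
    obtain ⟨c, hc⟩ := hd
    rw [hc] at hlt ⊢
    rw [mul_comm]
    refine Nat.mul_le_mul_left _ ?_
    by_contra! h
    have : (p ^ a - 1) * c ≤ (p ^ a - 1) * 1 := Nat.mul_le_mul_left _ (by omega)
    omega
  have hdig : 2 * a * (p - 1) ≤ ∑ i ∈ s, (p.digits (k i)).sum := by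
    refine Nat.le_of_mul_le_mul_left ?_ hQ
    calc (p ^ a - 1) * (2 * a * (p - 1))
        = (p - 1) * ∑ l ∈ Finset.range a, 2 * (p ^ a - 1) := by simp; ring
      _ ≤ (p - 1) * ∑ l ∈ Finset.range a, ∑ i ∈ s, g (k i) l :=
          Nat.mul_le_mul_left _ (Finset.sum_le_sum fun l _ => hrow l)
      _ = (p ^ a - 1) * ∑ i ∈ s, (p.digits (k i)).sum := by
          rw [Finset.sum_comm, Finset.mul_sum, Finset.mul_sum]
          exact Finset.sum_congr rfl fun i _ => hsum (k i)
  rw [padicValNat_dvd_iff_le (Nat.multinomial_pos s k).ne']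
  have hmul := Nat.sub_one_mul_padicValNat_multinomial (p := p) s k
  rw [hk, Nat.digits_sum_pow_mul_pow_sub_one hp1 ha] at hmul
  refine le_of_mul_le_mul_left (a := p - 1) ?_ (by omega)
  nlinarith

theorem FiniteField.sum_monoidHom_pow_eq_zero {F R : Type*} [Field F] [Fintype F] [CommRing R]
    [IsDomain R] {τ : F →* R} (hτ : Function.Injective τ) {e : ℕ}
    (he : ¬ Fintype.card F - 1 ∣ e) : ∑ t, τ t ^ e = 0 := by
  obtain ⟨u, hu⟩ := not_forall.1 (mt (FiniteField.forall_pow_eq_one_iff F e).1 he)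
  have hne : τ u ^ e ≠ 1 := by
    rw [← map_pow, ← map_one τ, hτ.ne_iff]
    exact fun h => hu (Units.ext (by simpa using h))
  have hinv : τ u ^ e * ∑ t, τ t ^ e = ∑ t, τ t ^ e := by
    rw [Finset.mul_sum]
    exact Fintype.sum_equiv (Units.mulLeft u) _ _ fun t => by simp [mul_pow]
  exact (mul_left_eq_self₀.1 hinv).resolve_left hne

theorem WittVector.natCast_dvd_iff {p : ℕ} [hp : Fact p.Prime] {k : Type*} [Field k] [CharP k p]
    [PerfectRing k p] (x : WittVector p k) : (p : WittVector p k) ∣ x ↔ x.coeff 0 = 0 := by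
  rw [← Ideal.mem_span_singleton, WittVector.mem_span_p_iff_coeff_zero_eq_zero]

theorem WittVector.natCast_pow_dvd_natCast {p : ℕ} [hp : Fact p.Prime] {k : Type*} [Field k]
    [CharP k p] [PerfectRing k p] {a N : ℕ} (h : (p : WittVector p k) ^ a ∣ N) : p ^ a ∣ N := by
  induction a generalizing N with
  | zero => simp
  | succ a ih =>
    have h1 : p ∣ N := by
      have h0 := (WittVector.natCast_dvd_iff _).1 ((dvd_pow_self _ a.succ_ne_zero).trans h)
      rw [← CharP.cast_eq_zero_iff k p, ← h0]
      exact (map_natCast (WittVector.constantCoeff : WittVector p k →+* k) N).symm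
    obtain ⟨N, rfl⟩ := h1
    rw [pow_succ']
    rw [pow_succ', Nat.cast_mul, mul_dvd_mul_iff_left (WittVector.p_nonzero p k)] at h
    exact mul_dvd_mul_left _ (ih h)

theorem WittVector.pow_dvd_pow_sub_ite {p : ℕ} [hp : Fact p.Prime] {F : Type*} [Field F]
    [Fintype F] [DecidableEq F] [CharP F p] {a : ℕ} (hF : Fintype.card F = p ^ a)
    (z : WittVector p F) :
    (p : WittVector p F) ^ a ∣
      z ^ (p ^ a * (p ^ a - 1)) - ((if z.coeff 0 ≠ 0 then 1 else 0 : ℕ) : WittVector p F) := by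
  have h1 : 1 < p ^ a := hF ▸ Fintype.one_lt_card
  split_ifs with hz
  · have h : (p : WittVector p F) ∣ z ^ (p ^ a - 1) - 1 := by
      rw [WittVector.natCast_dvd_iff]
      change WittVector.constantCoeff (z ^ (p ^ a - 1) - 1) = 0
      rw [map_sub, map_pow, map_one, sub_eq_zero, ← hF]
      exact FiniteField.pow_card_sub_one_eq_one _ hz
    have h2 := dvd_sub_pow_of_dvd_sub h a
    rw [one_pow, ← pow_mul, mul_comm] at h2
    simpa using (pow_dvd_pow _ a.le_succ).trans h2
  · rw [Nat.cast_zero, sub_zero]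
    have h : (p : WittVector p F) ∣ z := (WittVector.natCast_dvd_iff _).2 (not_not.1 hz)
    refine (pow_dvd_pow _ ?_).trans (pow_dvd_pow_of_dvd h _)
    exact (Nat.lt_pow_self hp.out.one_lt).le.trans (Nat.le_mul_of_pos_right _ (by omega))

/-- **Ax's theorem** for a single polynomial. -/
theorem MvPolynomial.card_dvd_card_eval_ne_zero {F σ : Type*} [Field F] [Fintype F]
    [DecidableEq F] [Fintype σ] [DecidableEq σ] (g : MvPolynomial σ F)
    (hg : g.totalDegree < Fintype.card σ) :
    Fintype.card F ∣ ∑ x : σ → F, if MvPolynomial.eval x g ≠ 0 then 1 else 0 := by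
  obtain ⟨p, hchar⟩ := CharP.exists F
  obtain ⟨⟨a, ha⟩, hp, hF⟩ := FiniteField.card F p
  have : Fact p.Prime := ⟨hp⟩
  simp only [PNat.mk_coe] at hF
  rw [hF]
  set τ : F →* WittVector p F := WittVector.teichmuller p
  have hcoeff (t : F) : WittVector.constantCoeff (τ t) = t := WittVector.teichmuller_coeff_zero p t
  have hinj : Function.Injective τ := Function.LeftInverse.injective hcoeff
  set M := p ^ a * (p ^ a - 1)
  let G (x : σ → F) : WittVector p F := ∑ w ∈ g.support, τ (g.coeff w * ∏ j, x j ^ w j)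
  have hG (x : σ → F) : (G x).coeff 0 = MvPolynomial.eval x g := by
    change WittVector.constantCoeff (G x) = _
    simp only [G, map_sum, hcoeff, MvPolynomial.eval_eq']
  have hGM : (p : WittVector p F) ^ a ∣ ∑ x, G x ^ M := by
    have hexp (x : σ → F) : G x ^ M = ∑ k ∈ Finset.piAntidiag g.support M,
        (Nat.multinomial g.support k : WittVector p F) * (∏ w ∈ g.support, τ (g.coeff w) ^ k w) *
          ∏ j, τ (x j) ^ ∑ w ∈ g.support, k w * w j := by
      rw [Finset.sum_pow_eq_sum_piAntidiag]
      refine Finset.sum_congr rfl fun k _ => ?_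
      simp only [map_mul, map_prod, map_pow, mul_pow, Finset.prod_mul_distrib, mul_assoc]
      congr 2
      simp only [← Finset.prod_pow, ← pow_mul, ← Finset.prod_pow_eq_pow_sum]
      rw [Finset.prod_comm]
      simp only [mul_comm]
    simp only [hexp]
    rw [Finset.sum_comm]
    refine Finset.dvd_sum fun k hk => ?_
    rw [← Finset.mul_sum, ← Fintype.piFinset_univ,
      ← Finset.prod_univ_sum (fun _ : σ => (Finset.univ : Finset F))
        (fun j t => τ t ^ ∑ w ∈ g.support, k w * w j)]
    by_cases hdiv : ∀ j, p ^ a - 1 ∣ ∑ w ∈ g.support, k w * w j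
    · by_cases hne : ∀ j, ∑ w ∈ g.support, k w * w j ≠ 0
      · refine ((?_ : _ ∣ _).mul_right _).mul_right _
        rw [← Nat.cast_pow]
        refine Nat.cast_dvd_cast (Nat.pow_dvd_multinomial_of_weights ha.ne' a g.support k
          (fun w j => w j) (Finset.mem_piAntidiag.1 hk).1 (fun w hw => ?_) hdiv hne)
        rw [← Finsupp.sum_fintype w (fun _ m => m) fun _ => rfl]
        exact (MvPolynomial.le_totalDegree hw).trans_lt hg
      · push Not at hne
        obtain ⟨j, hj⟩ := hne
        refine (dvd_trans ?_ (Finset.dvd_prod_of_mem _ (Finset.mem_univ j))).mul_left _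
        simp [hj, hF]
    · push Not at hdiv
      obtain ⟨j, hj⟩ := hdiv
      rw [← hF] at hj
      rw [Finset.prod_eq_zero (Finset.mem_univ j)
        (FiniteField.sum_monoidHom_pow_eq_zero hinj hj), mul_zero]
      exact dvd_zero _
  have hsub := Finset.dvd_sum (s := Finset.univ) fun x _ => WittVector.pow_dvd_pow_sub_ite hF (G x)
  rw [Finset.sum_sub_distrib, dvd_sub_right hGM] at hsub
  simp only [hG] at hsub
  rw [← Nat.cast_sum] at hsub
  exact WittVector.natCast_pow_dvd_natCast hsub

/-- **Ax's theorem** for a system of polynomial equations. -/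
theorem MvPolynomial.card_dvd_card_zeros {F σ ι : Type*} [Field F] [Fintype F] [Fintype σ]
    [Fintype ι] (f : ι → MvPolynomial σ F) (hf : ∑ j, (f j).totalDegree < Fintype.card σ) :
    Fintype.card F ∣ Nat.card {x : σ → F // ∀ j, MvPolynomial.eval x (f j) = 0} := by
  classical
  have hind (x : σ → F) :
      ((if ∀ j, MvPolynomial.eval x (f j) = 0 then 1 else 0 : ℕ) : ℤ) =
      ∑ S : Finset ι, (-1) ^ S.card *
        ((if MvPolynomial.eval x (∏ j ∈ S, f j) ≠ 0 then 1 else 0 : ℕ) : ℤ) := by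
    rw [Nat.cast_ite, Nat.cast_one, Nat.cast_zero, ← Fintype.prod_boole]
    calc ∏ j, (if MvPolynomial.eval x (f j) = 0 then 1 else 0 : ℤ)
        = ∏ j, (1 + if MvPolynomial.eval x (f j) ≠ 0 then -1 else 0 : ℤ) :=
          Finset.prod_congr rfl fun j _ => by split_ifs <;> simp_all
      _ = _ := by
        rw [Finset.prod_one_add, Finset.powerset_univ]
        refine Finset.sum_congr rfl fun S _ => ?_
        rw [Finset.prod_ite_zero]
        simp [Finset.prod_eq_zero_iff]
  rw [← Int.natCast_dvd_natCast, Nat.card_eq_fintype_card, Fintype.card_subtype,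
    Finset.card_filter, Nat.cast_sum]
  simp only [hind]
  rw [Finset.sum_comm]
  refine Finset.dvd_sum fun S _ => ?_
  rw [← Finset.mul_sum, ← Nat.cast_sum]
  refine (Int.natCast_dvd_natCast.2 (MvPolynomial.card_dvd_card_eval_ne_zero _ ?_)).mul_left _
  calc (∏ j ∈ S, f j).totalDegree ≤ ∑ j ∈ S, (f j).totalDegree :=
        MvPolynomial.totalDegree_finsetProd S f
    _ ≤ ∑ j, (f j).totalDegree := Finset.sum_le_sum_of_subset (Finset.subset_univ S)
    _ < Fintype.card σ := hf

theorem MvPolynomial.IsHomogeneous.eval_smul {R σ : Type*} [CommSemiring R] {φ : MvPolynomial σ R}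
    {d : ℕ} (hφ : φ.IsHomogeneous d) (c : R) (v : σ → R) :
    MvPolynomial.eval (c • v) φ = c ^ d * MvPolynomial.eval v φ := by
  rw [MvPolynomial.eval_eq, MvPolynomial.eval_eq, Finset.mul_sum]
  refine Finset.sum_congr rfl fun w hw => ?_
  have hw' : ∑ i ∈ w.support, w i = d := by
    rw [← hφ.degree_eq_sum_deg_support hw]
  simp only [Pi.smul_apply, smul_eq_mul, mul_pow, Finset.prod_mul_distrib,
    Finset.prod_pow_eq_pow_sum, hw']
  ring

theorem Projectivization.card_subtype_eq {k V : Type*} [Field k] [Finite k]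
    [AddCommGroup V] [Module k V] [Finite V] (P : V → Prop) (h0 : P 0)
    (hP : ∀ (c : kˣ) (v : V), P v → P (c • v)) :
    Nat.card {v // P v} = Nat.card {x : Projectivization k V |
      ∀ v : V, ∀ hv : v ≠ 0, Projectivization.mk k v hv = x → P v} * (Nat.card k - 1) + 1 := by
  classical
  set Z := {x : Projectivization k V |
    ∀ v : V, ∀ hv : v ≠ 0, Projectivization.mk k v hv = x → P v}
  have hmem (v : {v : V // v ≠ 0}) :
      P v ↔ (Projectivization.nonZeroEquivProjectivizationProdUnits k V v).1 ∈ Z := by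
    change _ ↔ Projectivization.mk k v.1 v.2 ∈ Z
    refine ⟨fun h w hw hwv => ?_, fun h => h v.1 v.2 rfl⟩
    obtain ⟨c, rfl⟩ := (Projectivization.mk_eq_mk_iff k w v.1 hw v.2).1 hwv
    exact hP c _ h
  let e₁ : {b : {v // P v} // b ≠ ⟨0, h0⟩} ≃ {v : {v : V // v ≠ 0} // P v} :=
    { toFun := fun b => ⟨⟨b.1.1, fun h => b.2 (Subtype.ext h)⟩, b.1.2⟩
      invFun := fun v => ⟨⟨v.1.1, v.2⟩, fun h => v.1.2 (congrArg Subtype.val h)⟩ }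
  let e₂ : {v : {v : V // v ≠ 0} // P v} ≃ Z × kˣ :=
    ((Projectivization.nonZeroEquivProjectivizationProdUnits k V).subtypeEquiv hmem).trans
      (Equiv.prodSubtypeFstEquivSubtypeProd (p := fun x => x ∈ Z))
  rw [← Nat.card_congr (Equiv.optionSubtypeNe (⟨0, h0⟩ : {v // P v})), Finite.card_option,
    Nat.card_congr (e₁.trans e₂), Nat.card_prod, Nat.card_units]

/-- **Ax–Katz congruence.** If `f_1, …, f_r` are homogeneous polynomials over `𝔽_q`
in `n + 1` variables of degrees `d_1, …, d_r ≥ 1` with `d_1 + ⋯ + d_r ≤ n`, then the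
number of points of `ℙ^n(𝔽_q)` on which all the `f_j` vanish is congruent to `1` mod `q`. -/
theorem statement0 (p a q : ℕ) (hp : p.Prime) (ha : 1 ≤ a) (hq : q = p ^ a)
    (F : Type) [Field F] [Fintype F] (hF : Fintype.card F = q)
    (n r : ℕ) (hn : 1 ≤ n) (hr : 1 ≤ r)
    (f : Fin r → MvPolynomial (Fin (n + 1)) F) (d : Fin r → ℕ)
    (hd : ∀ j, 1 ≤ d j) (hhom : ∀ j, (f j).IsHomogeneous (d j))
    (hsum : ∑ j, d j ≤ n) :
    Nat.card {x : Projectivization F (Fin (n + 1) → F) |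
        ∀ j : Fin r, ∀ v : Fin (n + 1) → F, ∀ hv : v ≠ 0,
          Projectivization.mk F v hv = x → MvPolynomial.eval v (f j) = 0}
      ≡ 1 [MOD q] := by
  have hdeg : ∑ j, (f j).totalDegree < Fintype.card (Fin (n + 1)) := by
    rw [Fintype.card_fin]
    exact Nat.lt_succ_of_le ((Finset.sum_le_sum fun j _ => (hhom j).totalDegree_le).trans hsum)
  have hdvd := MvPolynomial.card_dvd_card_zeros f hdeg
  have hcard := Projectivization.card_subtype_eq (k := F)
    (fun v : Fin (n + 1) → F => ∀ j, MvPolynomial.eval v (f j) = 0)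
    (fun j => by
      rw [← zero_smul F (0 : Fin (n + 1) → F), (hhom j).eval_smul,
        zero_pow (Nat.one_le_iff_ne_zero.1 (hd j)), zero_mul])
    (fun c v hv j => by rw [Units.smul_def, (hhom j).eval_smul, hv j, mul_zero])
  have hset : {x : Projectivization F (Fin (n + 1) → F) |
        ∀ j : Fin r, ∀ v : Fin (n + 1) → F, ∀ hv : v ≠ 0,
          Projectivization.mk F v hv = x → MvPolynomial.eval v (f j) = 0} =
      {x | ∀ v : Fin (n + 1) → F, ∀ hv : v ≠ 0,
          Projectivization.mk F v hv = x → ∀ j, MvPolynomial.eval v (f j) = 0} := by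
    ext x
    exact ⟨fun h v hv hx j => h j v hv hx, fun h j v hv hx => h v hv hx j⟩
  rw [hcard, Nat.card_eq_fintype_card (α := F), hF] at hdvd
  rw [hset]
  generalize Nat.card _ = N at hdvd ⊢
  have hq1 : 1 ≤ q := hF ▸ Fintype.card_pos
  rw [← Int.natCast_dvd_natCast] at hdvd
  push_cast [hq1] at hdvd
  rw [Nat.modEq_iff_dvd]
  have := hdvd.sub (dvd_mul_left (q : ℤ) N)
  rwa [show (N : ℤ) * (q - 1) + 1 - N * q = 1 - N by ring] at this
end

section
/- Let p be a prime, a ≥ 1 an integer, q = p^a, and κ ≥ 1 an integer. Let α_1, …, α_m and β_1, …, β_n be algebraic integers (complex numbers integral over ℤ) such that α_i ≠ β_j for all i, j. Assume that for every integer r ≥ 1 the number N_r := Σ_{j=1}^{n} β_j^r − Σ_{i=1}^{m} α_i^r is a rational integer. Then the following are equivalent: (i) for all r ≥ 1, q^{κ·r} divides N_r in ℤ; (ii) for all i and all j, the numbers α_i / q^κ and β_j / q^κ are algebraic integers (i.e. q^κ divides each α_i and each β_j in the ring of algebraic integers). -/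
/-- If every positive power of `x` lies in a finitely generated `ℤ`-submodule, then `x` is
integral over `ℤ`. -/
theorem isIntegral_int_of_pow_mem_fg {K : Type*} [Field K] {x : K} (W : Submodule ℤ K)
    (hW : W.FG) (h : ∀ r : ℕ, 1 ≤ r → x ^ r ∈ W) : IsIntegral ℤ x := by
  have hfg : (W ⊔ Submodule.span ℤ {1}).FG := hW.sup (Submodule.fg_span_singleton 1)
  have hle : Subalgebra.toSubmodule (Algebra.adjoin ℤ {x}) ≤ W ⊔ Submodule.span ℤ {1} := by
    rw [Algebra.adjoin_singleton_eq_range_aeval]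
    rintro _ ⟨P, rfl⟩
    change Polynomial.aeval x P ∈ _
    rw [Polynomial.aeval_eq_sum_range]
    refine Submodule.sum_mem _ fun i _ => Submodule.smul_mem _ _ ?_
    rcases Nat.eq_zero_or_pos i with rfl | hi
    · rw [pow_zero]
      exact Submodule.mem_sup_right (Submodule.mem_span_singleton_self 1)
    · exact Submodule.mem_sup_left (h i hi)
  exact IsIntegral.of_mem_of_fg (Algebra.adjoin ℤ {x}) (Submodule.FG.of_le hfg hle) x
    (Algebra.self_mem_adjoin_singleton ℤ x)

/-- If the weighted power sums `∑ c y * y ^ r` over a finite set are integers for all `r ≥ 1`,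
then every element of nonzero weight is integral over `ℤ`. -/
theorem isIntegral_int_of_weighted_power_sums {K : Type*} [Field K] (s : Finset K) (c : K → K)
    (M : ℕ → ℤ) (hM : ∀ r : ℕ, 1 ≤ r → ∑ y ∈ s, c y * y ^ r = (M r : K))
    {x : K} (hx : x ∈ s) (hc : c x ≠ 0) : IsIntegral ℤ x := by
  classical
  set P := Lagrange.basis s id x with hP
  let W : Submodule ℤ K :=
    Submodule.span ℤ (((Finset.range (P.natDegree + 1)).image fun i => P.coeff i / c x : Finset K) :
      Set K)
  refine isIntegral_int_of_pow_mem_fg W ⟨_, rfl⟩ fun r hr => ?_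
  have hsum : c x * x ^ r = ∑ i ∈ Finset.range (P.natDegree + 1), P.coeff i * (M (r + i) : K) := by
    calc c x * x ^ r = ∑ y ∈ s, c y * y ^ r * P.eval y := by
          rw [Finset.sum_eq_single_of_mem x hx]
          · have := Lagrange.eval_basis_self (v := id) Function.injective_id.injOn hx
            simp only [id] at this
            rw [hP, this, mul_one]
          · intro y hy hyx
            have := Lagrange.eval_basis_of_ne (v := id) hyx.symm hy
            simp only [id] at this
            rw [hP, this, mul_zero]
      _ = _ := by
          simp_rw [← hM _ (hr.trans (Nat.le_add_right r _)), Polynomial.eval_eq_sum_range,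
            Finset.mul_sum]
          rw [Finset.sum_comm]
          exact Finset.sum_congr rfl fun i _ => Finset.sum_congr rfl fun y _ => by ring
  have hpow : x ^ r = ∑ i ∈ Finset.range (P.natDegree + 1), M (r + i) • (P.coeff i / c x) := by
    rw [← mul_right_inj' hc, hsum, Finset.mul_sum]
    refine Finset.sum_congr rfl fun i _ => ?_
    rw [zsmul_eq_mul]
    field_simp
  rw [hpow]
  exact Submodule.sum_mem _ fun i hi => Submodule.smul_mem _ _
    (Submodule.subset_span (Finset.mem_coe.2 (Finset.mem_image_of_mem _ hi)))

/-- If the differences of power sums of two disjoint finite families in a field of characteristic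
zero are integers for all `r ≥ 1`, then all members of both families are integral over `ℤ`. -/
theorem isIntegral_int_of_power_sums_sub {K ι ι' : Type*} [Field K] [CharZero K] [Fintype ι]
    [Fintype ι'] (α : ι → K) (β : ι' → K) (hne : ∀ i j, α i ≠ β j) (M : ℕ → ℤ)
    (hM : ∀ r : ℕ, 1 ≤ r → ∑ j, β j ^ r - ∑ i, α i ^ r = (M r : K)) :
    (∀ i, IsIntegral ℤ (α i)) ∧ ∀ j, IsIntegral ℤ (β j) := by
  classical
  let s : Finset K := Finset.univ.image α ∪ Finset.univ.image β
  let c : K → K := fun y => (∑ j, if β j = y then 1 else 0) - ∑ i, if α i = y then 1 else 0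
  have hαs : ∀ i, α i ∈ s := fun i =>
    Finset.mem_union_left _ (Finset.mem_image_of_mem _ (Finset.mem_univ i))
  have hβs : ∀ j, β j ∈ s := fun j =>
    Finset.mem_union_right _ (Finset.mem_image_of_mem _ (Finset.mem_univ j))
  have hc : ∀ r : ℕ, 1 ≤ r → ∑ y ∈ s, c y * y ^ r = (M r : K) := by
    intro r hr
    simp only [← hM r hr, c, sub_mul, Finset.sum_sub_distrib, Finset.sum_mul, ite_mul, one_mul,
      zero_mul]
    rw [Finset.sum_comm, Finset.sum_comm (s := s)]
    simp [hαs, hβs]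
  constructor
  · intro i
    refine isIntegral_int_of_weighted_power_sums s c M hc (hαs i) ?_
    have h0 : ∀ j, β j ≠ α i := fun j => (hne i j).symm
    simp [c, h0]
  · intro j
    refine isIntegral_int_of_weighted_power_sums s c M hc (hβs j) ?_
    simp [c, hne]

/-- **Ax's lemma (Proposition 6.3, (i) ⟺ (ii)).** Let `q = p^a`, `κ ≥ 1`, and let
`α_1, …, α_m`, `β_1, …, β_n` be algebraic integers with `α_i ≠ β_j` for all `i, j`,
such that `N_r = Σ_j β_j^r − Σ_i α_i^r` is a rational integer for every `r ≥ 1`.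
Then `q^{κ r} ∣ N_r` for all `r ≥ 1` iff every `α_i / q^κ` and every `β_j / q^κ`
is an algebraic integer. -/
theorem statement1 (p a q : ℕ) (hp : p.Prime) (ha : 1 ≤ a) (hq : q = p ^ a)
    (κ : ℕ) (hκ : 1 ≤ κ) (m n : ℕ) (α : Fin m → ℂ) (β : Fin n → ℂ)
    (hα : ∀ i, IsIntegral ℤ (α i)) (hβ : ∀ j, IsIntegral ℤ (β j))
    (hne : ∀ i j, α i ≠ β j)
    (N : ℕ → ℤ)
    (hN : ∀ r : ℕ, 1 ≤ r → (N r : ℂ) = ∑ j, β j ^ r - ∑ i, α i ^ r) :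
    (∀ r : ℕ, 1 ≤ r → (q : ℤ) ^ (κ * r) ∣ N r) ↔
      ((∀ i, IsIntegral ℤ (α i / (q : ℂ) ^ κ)) ∧
        (∀ j, IsIntegral ℤ (β j / (q : ℂ) ^ κ))) := by
  have hQ : (q : ℂ) ^ κ ≠ 0 := by
    rw [hq]
    exact pow_ne_zero _ (Nat.cast_ne_zero.2 (pow_ne_zero _ hp.ne_zero))
  have hscale : ∀ r : ℕ, 1 ≤ r → ∑ j, (β j / (q : ℂ) ^ κ) ^ r - ∑ i, (α i / (q : ℂ) ^ κ) ^ r =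
      (N r : ℂ) / (q : ℂ) ^ (κ * r) := by
    intro r hr
    simp only [hN r hr, div_pow, ← Finset.sum_div, ← sub_div, ← pow_mul]
  have hQr : ∀ r : ℕ, (q : ℂ) ^ (κ * r) ≠ 0 := fun r => by
    rw [pow_mul]
    exact pow_ne_zero _ hQ
  constructor
  · intro h
    refine isIntegral_int_of_power_sums_sub _ _ (fun i j hij => hne i j ?_)
      (fun r => N r / (q : ℤ) ^ (κ * r)) fun r hr => ?_
    · exact (div_left_inj' hQ).1 hij
    · obtain ⟨k, hk⟩ := h r hr
      have hqz : (q : ℤ) ^ (κ * r) ≠ 0 := by exact_mod_cast hQr r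
      rw [hscale r hr, hk, Int.mul_ediv_cancel_left _ hqz, div_eq_iff (hQr r)]
      push_cast
      ring
  · rintro ⟨h₁, h₂⟩ r hr
    have hint : IsIntegral ℤ ((N r : ℂ) / (q : ℂ) ^ (κ * r)) := by
      rw [← hscale r hr]
      exact (IsIntegral.sum _ fun j _ => (h₂ j).pow r).sub (IsIntegral.sum _ fun i _ => (h₁ i).pow r)
    have hrat : IsIntegral ℤ ((N r : ℚ) / (q : ℚ) ^ (κ * r)) := by
      rw [← isIntegral_algebraMap_iff (algebraMap ℚ ℂ).injective]
      simpa using hint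
    obtain ⟨k, hk⟩ := IsIntegrallyClosed.isIntegral_iff.1 hrat
    have hqr : (q : ℚ) ^ (κ * r) ≠ 0 := by exact_mod_cast hQr r
    refine ⟨k, ?_⟩
    rw [eq_comm, div_eq_iff hqr] at hk
    have : (N r : ℚ) = k * (q : ℚ) ^ (κ * r) := hk
    rw [mul_comm]
    exact_mod_cast this
end
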